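/- Let A and B be k-algebras of finite transcendence degree over k which are integral domains, and let P be a prime ideal of A⊗_kB with p = P∩A and q = P∩B. Then λ((·,(0)),P) ≤ t.d.(A) − t.d.(A/p) + ht(q[t.d.(A/p)]) + ht(P/(p⊗_kB + A⊗_kq)), where λ((·,(0)),P) is the maximum of lengths s of chains of prime ideals P_0 ⊂ P_1 ⊂ ... ⊂ P_s = P of A⊗_kB such that P_i∩B = (0) for i = 0,1,...,s−1, and q[t.d.(A/p)] denotes the extension of q to the polynomial ring B[X_1,...,X_{t.d.(A/p)}]. -/

import Mathlib

open TensorProduct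

noncomputable section

/-- Transcendence degree of the `R`-algebra `A` as a cardinal: the supremum of the
cardinalities of algebraically independent subsets of `A` over `R`. -/
def trdegC (R A : Type*) [CommRing R] [CommRing A] [Algebra R A] : Cardinal :=
  ⨆ s : { s : Set A // AlgebraicIndependent R ((↑) : s → A) }, Cardinal.mk s.1

/-- Transcendence degree of the `R`-algebra `A`, as an extended natural number. -/
def eTrdeg (R A : Type*) [CommRing R] [CommRing A] [Algebra R A] : ℕ∞ :=
  Cardinal.toENat (trdegC R A)

/-- Height of an ideal: the infimum of the heights of the prime ideals containing it,
the height of a prime being taken in the prime spectrum ordered by inclusion. -/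
def idealHt {R : Type*} [CommRing R] (I : Ideal R) : ℕ∞ :=
  ⨅ P : { P : PrimeSpectrum R // I ≤ P.asIdeal }, Order.height P.1

/-- The extension `p[n]` of an ideal `p` of `A` to the polynomial ring
`A[X_1, ..., X_n]`. -/
def polyExt {A : Type*} [CommRing A] (n : ℕ) (p : Ideal A) : Ideal (MvPolynomial (Fin n) A) :=
  p.map (MvPolynomial.C : A →+* MvPolynomial (Fin n) A)

/-- An AF-domain over `k`: a `k`-algebra which is an integral domain such that
`ht p + t.d.(A/p) = t.d.(A)` for every prime ideal `p` of `A`. -/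
def IsAFDomain (k A : Type*) [Field k] [CommRing A] [IsDomain A] [Algebra k A] : Prop :=
  ∀ p : Ideal A, p.IsPrime → idealHt p + eTrdeg k (A ⧸ p) = eTrdeg k A

/-- `λ((·,(0)), P)`: the maximum of lengths `s` of chains of prime ideals
`P_0 ⊂ P_1 ⊂ ... ⊂ P_s = P` of `A ⊗[k] B` such that `P_i ∩ B = (0)` for `i < s`. -/
def lamZero (k A B : Type*) [Field k] [CommRing A] [CommRing B] [Algebra k A] [Algebra k B]
    (P : Ideal (A ⊗[k] B)) : ℕ∞ :=
  sSup {n : ℕ∞ | ∃ (s : ℕ) (c : Fin (s + 1) → Ideal (A ⊗[k] B)),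
    n = s ∧ StrictMono c ∧ (∀ i, (c i).IsPrime) ∧ c (Fin.last s) = P ∧
    ∀ i : Fin (s + 1), i ≠ Fin.last s →
      (c i).comap (Algebra.TensorProduct.includeRight : B →ₐ[k] A ⊗[k] B).toRingHom = ⊥}

universe u

theorem eTrdeg_eq_toENat_trdeg (R A : Type*) [CommRing R] [CommRing A] [Algebra R A] :
    eTrdeg R A = Cardinal.toENat (Algebra.trdeg R A) := rfl

theorem eTrdeg_le_of_injective {R : Type*} {A A' : Type u} [CommRing R] [CommRing A]
    [CommRing A'] [Algebra R A] [Algebra R A'] (f : A →ₐ[R] A') (hf : Function.Injective f) :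
    eTrdeg R A ≤ eTrdeg R A' :=
  Cardinal.toENat.monotone' (trdeg_le_of_injective f hf)

theorem eTrdeg_le_of_surjective {R : Type*} {A A' : Type u} [CommRing R] [CommRing A]
    [CommRing A'] [Algebra R A] [Algebra R A'] (f : A →ₐ[R] A') (hf : Function.Surjective f) :
    eTrdeg R A' ≤ eTrdeg R A :=
  Cardinal.toENat.monotone' (trdeg_le_of_surjective f hf)

theorem idealHt_eq_height {R : Type*} [CommRing R] (I : Ideal R) [hI : I.IsPrime] :
    idealHt I = I.height := by
  rw [show I.height = _ from PrimeSpectrum.height_eq_orderHeight ⟨I, hI⟩]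
  refine le_antisymm (iInf_le_of_le ⟨⟨I, hI⟩, le_rfl⟩ le_rfl) (le_iInf fun J => ?_)
  exact Order.height_mono J.2

theorem Ideal.height_le_height_of_hasGoingDown {R S : Type*} [CommRing R] [CommRing S]
    [Algebra R S] [Algebra.HasGoingDown R S] (p : Ideal R) [p.IsPrime] (P : Ideal S) [P.IsPrime]
    [P.LiesOver p] : p.height ≤ P.height := by
  rw [show p.height = _ from PrimeSpectrum.height_eq_orderHeight ⟨p, ‹_›⟩,
    show P.height = _ from PrimeSpectrum.height_eq_orderHeight ⟨P, ‹_›⟩]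
  refine Order.height_le fun l hl => ?_
  have : P.LiesOver l.last.asIdeal := by rw [hl]; infer_instance
  obtain ⟨L, hlen, hlast, -⟩ := Ideal.exists_ltSeries_of_hasGoingDown l P
  rw [← hlen, ← hlast]
  exact Order.length_le_height_last

section Polynomial

open Polynomial

theorem Ideal.comap_C_map_C {D : Type*} [CommRing D] (I : Ideal D) :
    (I.map (C : D →+* D[X])).comap C = I := by
  ext a
  rw [Ideal.mem_comap, Ideal.mem_map_C_iff]
  refine ⟨fun h => by simpa using h 0, fun h n => ?_⟩
  rw [coeff_C]
  split_ifs
  exacts [h, I.zero_mem]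

theorem Ideal.height_le_height_map_C {D : Type*} [CommRing D] (I : Ideal D) [I.IsPrime] :
    I.height ≤ (I.map (C : D →+* D[X])).height := by
  rw [show I.height = _ from PrimeSpectrum.height_eq_orderHeight ⟨I, ‹_›⟩,
    show (I.map C).height = _ from PrimeSpectrum.height_eq_orderHeight ⟨I.map C, inferInstance⟩]
  refine Order.height_le_height_apply_of_strictMono
    (fun J : PrimeSpectrum D =>
      (⟨J.asIdeal.map (C : D →+* D[X]), inferInstance⟩ : PrimeSpectrum D[X]))
    (Monotone.strictMono_of_injective (fun J K h => Ideal.map_mono h) fun J K h => ?_) ⟨I, ‹_›⟩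
  have h' := congrArg (fun L : PrimeSpectrum D[X] => L.asIdeal.comap (C : D →+* D[X])) h
  simp only [Ideal.comap_C_map_C] at h'
  exact PrimeSpectrum.ext h'

theorem eTrdeg_add_height_polynomial {B D : Type u} [CommRing B] [IsDomain B] [CommRing D]
    [Algebra B D] (Q : Ideal D[X]) [Q.IsPrime] (hQ : (Q.comap C).comap (algebraMap B D) = ⊥) :
    eTrdeg B (D ⧸ Q.comap C) + (Q.comap C).height + 1 ≤ eTrdeg B (D[X] ⧸ Q) + Q.height := by
  have hle : (Q.comap C).map C ≤ Q := Ideal.map_comap_le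
  have hht := (Q.comap C).height_le_height_map_C
  rcases hle.eq_or_lt with h | h
  · rw [add_right_comm]
    rw [h] at hht
    refine add_le_add ?_ hht
    have : FaithfulSMul B (D ⧸ Q.comap C) := by
      rw [faithfulSMul_iff_algebraMap_injective, injective_iff_map_eq_zero]
      intro b hb
      rw [← Ideal.mem_bot, ← hQ]
      rw [IsScalarTower.algebraMap_apply B D] at hb
      exact (Ideal.Quotient.eq_zero_iff_mem (I := Q.comap C)).mp hb
    have h1 := trdeg_add_le (R := B) (S := D ⧸ Q.comap C) (A := (D ⧸ Q.comap C)[X])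
    rw [Polynomial.trdeg_of_isDomain] at h1
    have h2 : Cardinal.toENat _ ≤ Cardinal.toENat _ := Cardinal.toENat.monotone' h1
    rw [map_add, map_one] at h2
    refine le_trans h2 ?_
    refine eTrdeg_le_of_surjective (Ideal.Quotient.liftₐ Q
      (mapAlgHom (Ideal.Quotient.mkₐ B (Q.comap C))) fun a ha => ?_) ?_
    · rw [← h, Ideal.mem_map_C_iff] at ha
      ext n
      simpa [Ideal.Quotient.eq_zero_iff_mem] using ha n
    · refine Ideal.Quotient.lift_surjective_of_surjective _ _ ?_
      exact Polynomial.map_surjective _ Ideal.Quotient.mk_surjective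
  · rw [add_assoc]
    refine add_le_add ?_ ?_
    · refine eTrdeg_le_of_injective (Ideal.quotientMapₐ Q (CAlgHom : D →ₐ[B] D[X]) le_rfl) ?_
      exact Ideal.quotientMap_injective
    · exact (add_le_add_left hht 1).trans (Ideal.height_add_one_le_of_lt_of_isPrime h)

end Polynomial

section MvPolynomial

open MvPolynomial

theorem le_eTrdeg_add_height {B : Type u} [CommRing B] [IsDomain B] (n : ℕ)
    (Q : Ideal (MvPolynomial (Fin n) B)) [Q.IsPrime] (hQ : Q.comap C = ⊥) :
    (n : ℕ∞) ≤ eTrdeg B (MvPolynomial (Fin n) B ⧸ Q) + Q.height := by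
  induction n with
  | zero => simp
  | succ n ih =>
    let e := finSuccEquiv B n
    let Q' : Ideal (Polynomial (MvPolynomial (Fin n) B)) := Q.comap e.symm.toAlgHom
    have hQ' : (Q'.comap Polynomial.C).comap (algebraMap B (MvPolynomial (Fin n) B)) = ⊥ := by
      rw [← hQ]
      ext b
      rw [Ideal.mem_comap, Ideal.mem_comap, Ideal.mem_comap, Ideal.mem_comap]
      have : e.symm.toAlgHom (Polynomial.C (algebraMap B (MvPolynomial (Fin n) B) b)) = C b :=
        e.symm.commutes b
      rw [this]
    have h1 := eTrdeg_add_height_polynomial Q' hQ'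
    have h2 : Q'.height = Q.height := RingEquiv.height_comap e.symm.toRingEquiv Q
    have h3 : eTrdeg B (_ ⧸ Q') ≤ eTrdeg B (_ ⧸ Q) :=
      eTrdeg_le_of_injective (Ideal.quotientMapₐ Q e.symm.toAlgHom le_rfl)
        Ideal.quotientMap_injective
    rw [h2] at h1
    push_cast
    exact (add_le_add_left (ih (Q'.comap Polynomial.C) hQ') 1).trans
      (h1.trans (add_le_add_left h3 _))

instance isPrime_polyExt {B : Type*} [CommRing B] (n : ℕ) (q : Ideal B) [q.IsPrime] :
    (polyExt n q).IsPrime := by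
  have h := MvPolynomial.ker_map (σ := Fin n) (Ideal.Quotient.mk q)
  rw [Ideal.mk_ker] at h
  rw [polyExt, ← h]
  exact RingHom.ker_isPrime _

theorem height_polyExt_mono {B : Type*} [CommRing B] (q : Ideal B) [q.IsPrime] :
    Monotone fun n => (polyExt n q).height := by
  refine monotone_nat_of_le_succ fun n => ?_
  refine (polyExt n q).height_le_height_map_C.trans ?_
  rw [← RingEquiv.height_comap (finSuccEquiv B n).toRingEquiv]
  refine Ideal.height_mono ?_
  intro f hf
  rw [polyExt, MvPolynomial.mem_map_C_iff]
  intro m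
  have h := (Ideal.mem_map_C_iff.mp hf) (m 0)
  rw [polyExt, MvPolynomial.mem_map_C_iff] at h
  have := h m.tail
  have h3 := finSuccEquiv_coeff_coeff m.tail f (m 0)
  rw [Finsupp.cons_tail] at h3
  rw [← h3]
  exact this

end MvPolynomial

theorem exists_isTranscendenceBasis_fin {R A : Type*} [CommRing R] [Nontrivial R] [CommRing A]
    [IsDomain A] [Algebra R A] (hinj : Function.Injective (algebraMap R A)) {n : ℕ}
    (h : eTrdeg R A = n) : ∃ x : Fin n → A, IsTranscendenceBasis R x := by
  have := (faithfulSMul_iff_algebraMap_injective R A).mpr hinj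
  obtain ⟨s, hs⟩ := exists_isTranscendenceBasis R A
  have hc : Cardinal.mk s = n := by
    rw [hs.cardinalMk_eq_trdeg, ← Cardinal.toENat_eq_natCast, ← h]; rfl
  obtain ⟨e⟩ := Cardinal.mk_eq_nat_iff.mp hc
  exact ⟨_, (isTranscendenceBasis_equiv e.symm).mpr hs⟩

theorem AlgebraicIndependent.le_eTrdeg {R A : Type*} [CommRing R] [Nontrivial R] [CommRing A]
    [Algebra R A] {n : ℕ} {x : Fin n → A} (hx : AlgebraicIndependent R x) :
    (n : ℕ∞) ≤ eTrdeg R A := by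
  have h := hx.lift_cardinalMk_le_trdeg
  rw [eTrdeg_eq_toENat_trdeg, Cardinal.natCast_le_toENat]
  simpa using h

theorem eTrdeg_add_one_le_of_surjective {B S S' : Type u} [CommRing B] [IsDomain B]
    [CommRing S] [IsDomain S] [CommRing S'] [IsDomain S'] [Algebra B S] [Algebra B S']
    (hinj : Function.Injective (algebraMap B S')) (f : S →ₐ[B] S') (hf : Function.Surjective f)
    (hf' : ¬ Function.Injective f) : eTrdeg B S' + 1 ≤ eTrdeg B S := by
  have hle := eTrdeg_le_of_surjective f hf
  rcases eq_or_ne (eTrdeg B S') ⊤ with h | h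
  · rw [h] at hle ⊢; simpa using hle
  obtain ⟨n, hn⟩ := ENat.ne_top_iff_exists.mp h
  obtain ⟨y, hy⟩ := exists_isTranscendenceBasis_fin hinj hn.symm
  choose x hx using fun i => hf (y i)
  have hxy : f ∘ x = y := funext hx
  have hxi : AlgebraicIndependent B x := AlgebraicIndependent.of_comp f (hxy ▸ hy.1)
  by_contra hcon
  have hcon' : eTrdeg B S ≤ n := by
    rw [← hn, not_le, ENat.lt_add_one_iff (ENat.natCast_ne_top n)] at hcon
    exact hcon
  have hbasis : IsTranscendenceBasis B x := by
    refine hxi.isTranscendenceBasis_of_lift_trdeg_le_of_finite ?_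
    have : Algebra.trdeg B S ≤ n := Cardinal.toENat_le_natCast.mp hcon'
    simpa using this
  have halg := hbasis.isAlgebraic
  rw [injective_iff_map_eq_zero] at hf'
  push Not at hf'
  obtain ⟨a, ha, ha0⟩ := hf'
  obtain ⟨r, hr0, hr⟩ := (halg.isAlgebraic a).exists_nonzero_dvd
    (mem_nonZeroDivisors_of_ne_zero ha0)
  obtain ⟨p, hp⟩ : ∃ p : MvPolynomial (Fin n) B, MvPolynomial.aeval x p = (r : S) := by
    exact (Algebra.adjoin_range_eq_range_aeval B x).le r.2
  have h0 : MvPolynomial.aeval y p = 0 := by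
    obtain ⟨c, hc⟩ := hr
    have hc' : (r : S) = a * c := hc
    have h1 := MvPolynomial.comp_aeval_apply x f p
    rw [hp, hc', map_mul, ha, zero_mul, funext hx] at h1
    exact h1.symm
  have hp0 : p = 0 := (injective_iff_map_eq_zero _).mp hy.1 p h0
  exact hr0 (Subtype.ext (by rw [← hp, hp0, map_zero]; rfl))

theorem eTrdeg_le_of_adjoin_range_eq_top {k A B T : Type u} [Field k] [CommRing A] [CommRing B]
    [IsDomain B] [CommRing T] [IsDomain T] [Algebra k A] [Algebra k B] [Algebra k T] [Algebra B T]
    [IsScalarTower k B T] (f : A →ₐ[k] T) (hf : Algebra.adjoin B (Set.range f) = ⊤) :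
    eTrdeg B T ≤ eTrdeg k A := by
  refine le_trans ?_ (eTrdeg_le_of_surjective f.rangeRestrict f.rangeRestrict_surjective)
  obtain ⟨s, hs⟩ := exists_isTranscendenceBasis k f.range
  let s' : Set T := Subtype.val '' s
  have halg : Algebra.IsAlgebraic (Algebra.adjoin B s') T := by
    have hs' := hs.isAlgebraic
    rw [Subtype.range_coe] at hs'
    have hmem : ∀ r : Algebra.adjoin k s, ((r : f.range) : T) ∈ Algebra.adjoin B s' := by
      rintro ⟨r, hr⟩
      have hle : Algebra.adjoin k s ≤
          ((Algebra.adjoin B s').restrictScalars k).comap f.range.val :=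
        Algebra.adjoin_le fun u hu =>
          Algebra.subset_adjoin (R := B) (s := s') (Set.mem_image_of_mem Subtype.val hu)
      exact hle hr
    let g : Algebra.adjoin k s →+* Algebra.adjoin B s' :=
      ((algebraMap f.range T).comp (algebraMap (Algebra.adjoin k s) f.range)).codRestrict
        (Algebra.adjoin B s') hmem
    have hA : ∀ a : A, IsAlgebraic (Algebra.adjoin B s') (f a) := by
      intro a
      refine IsAlgebraic.ringHom_of_comp_eq g (algebraMap f.range T)
        (hs'.isAlgebraic (⟨f a, a, rfl⟩ : f.range)) ?_ rfl
      intro u v huv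
      exact Subtype.ext (Subtype.ext (congrArg (fun w : Algebra.adjoin B s' => (w : T)) huv))
    refine ⟨fun z => ?_⟩
    have hz : z ∈ Algebra.adjoin B (Set.range f) := hf ▸ Algebra.mem_top
    exact Algebra.adjoin_le (S := (Subalgebra.algebraicClosure (Algebra.adjoin B s')
      T).restrictScalars B) (by rintro _ ⟨a, rfl⟩; exact hA a) hz
  have h1 : Algebra.trdeg B T ≤ Cardinal.mk s' := Algebra.IsAlgebraic.trdeg_le_cardinalMk B s'
  refine Cardinal.toENat.monotone' (h1.trans ?_)
  exact Cardinal.mk_image_le.trans hs.cardinalMk_eq_trdeg.le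

theorem le_eTrdeg_add_height_polyExt {B R : Type u} [CommRing B] [IsDomain B] [CommRing R]
    [Algebra B R] {n : ℕ} (x : Fin n → R) (I P : Ideal R) [I.IsPrime] (hIP : I ≤ P)
    (hI : I.comap (algebraMap B R) = ⊥) (q : Ideal B) [q.IsPrime]
    (hx : ∀ f, MvPolynomial.aeval x f ∈ P → f ∈ polyExt n q) :
    (n : ℕ∞) ≤ eTrdeg B (R ⧸ I) + (polyExt n q).height ∧
      (q ≠ ⊥ → (n : ℕ∞) + 1 ≤ eTrdeg B (R ⧸ I) + (polyExt n q).height) := by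
  let Z := I.comap (MvPolynomial.aeval x : MvPolynomial (Fin n) B →ₐ[B] R)
  have hZ : Z.comap MvPolynomial.C = ⊥ := by
    rw [← hI]
    ext b
    rw [Ideal.mem_comap, Ideal.mem_comap, Ideal.mem_comap, MvPolynomial.aeval_C]
  have h1 := le_eTrdeg_add_height n Z hZ
  have h2 : eTrdeg B (_ ⧸ Z) ≤ eTrdeg B (R ⧸ I) :=
    eTrdeg_le_of_injective (Ideal.quotientMapₐ I (MvPolynomial.aeval x) le_rfl)
      Ideal.quotientMap_injective
  have hle : Z ≤ polyExt n q := fun f hf => hx f (hIP hf)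
  refine ⟨h1.trans (add_le_add h2 (Ideal.height_mono hle)), fun hq => ?_⟩
  have hlt : Z < polyExt n q := by
    refine hle.lt_of_ne fun h => hq ?_
    rw [eq_bot_iff, ← hZ, h]
    exact Ideal.le_comap_map
  refine (add_le_add_left h1 1).trans ?_
  rw [add_assoc]
  exact add_le_add h2 (Ideal.height_add_one_le_of_lt_of_isPrime hlt)

section TensorProduct

attribute [local instance] Algebra.TensorProduct.rightAlgebra

theorem MvPolynomial.flat_aeval_of_algebraicIndependent {k F : Type*} [Field k] [Field F]
    [Algebra k F] {ι : Type*} {x : ι → F} (hx : AlgebraicIndependent k x) :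
    (MvPolynomial.aeval x : MvPolynomial ι k →ₐ[k] F).toRingHom.Flat := by
  let K := FractionRing (MvPolynomial ι k)
  let g : K →+* F := IsFractionRing.lift (A := MvPolynomial ι k)
    (g := (MvPolynomial.aeval x : MvPolynomial ι k →ₐ[k] F).toRingHom) hx
  have h : (MvPolynomial.aeval x : MvPolynomial ι k →ₐ[k] F).toRingHom =
      g.comp (algebraMap (MvPolynomial ι k) K) := by
    exact RingHom.ext fun f => (IsFractionRing.lift_algebraMap (K := K) (L := F) hx f).symm
  rw [h]
  refine RingHom.Flat.comp ?_ (RingHom.Flat.of_isField (Field.toIsField K) g)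
  rw [RingHom.flat_algebraMap_iff]
  exact IsLocalization.flat K (nonZeroDivisors _)

theorem le_eTrdeg_add_height_tensorProduct {k A B : Type u} [Field k] [CommRing A] [IsDomain A]
    [CommRing B] [IsDomain B] [Algebra k A] [Algebra k B] (N : Ideal (A ⊗[k] B)) [N.IsPrime]
    (hNA : N.comap (algebraMap A (A ⊗[k] B)) = ⊥) (hNB : N.comap (algebraMap B (A ⊗[k] B)) = ⊥)
    {r : ℕ} {x : Fin r → A} (hx : AlgebraicIndependent k x) :
    (r : ℕ∞) ≤ eTrdeg B ((A ⊗[k] B) ⧸ N) + N.height := by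
  let F := FractionRing A
  let i : A →ₐ[k] F := IsScalarTower.toAlgHom k A F
  let ι : A ⊗[k] B →ₐ[k] F ⊗[k] B := Algebra.TensorProduct.map i (AlgHom.id k B)
  let y : Fin r → F := fun j => algebraMap A F (x j)
  have hy : AlgebraicIndependent k y := hx.map' (f := i) (IsFractionRing.injective A F)
  let a : MvPolynomial (Fin r) B →ₐ[B] A ⊗[k] B := MvPolynomial.aeval fun j => x j ⊗ₜ 1
  let Q := N.comap a
  have hQ : Q.comap MvPolynomial.C = ⊥ := by
    rw [← hNB]
    ext b
    rw [Ideal.mem_comap, Ideal.mem_comap, Ideal.mem_comap]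
    exact iff_of_eq (congrArg (· ∈ N) (MvPolynomial.aeval_C _ b))
  have h1 := le_eTrdeg_add_height r Q hQ
  have h2 : eTrdeg B (_ ⧸ Q) ≤ eTrdeg B ((A ⊗[k] B) ⧸ N) :=
    eTrdeg_le_of_injective (Ideal.quotientMapₐ N a le_rfl) Ideal.quotientMap_injective
  refine h1.trans (add_le_add h2 ?_)
  let h : MvPolynomial (Fin r) B →+* F ⊗[k] B := ι.toRingHom.comp a.toRingHom
  have hflat : h.Flat := by
    have key : h =
        ((Algebra.TensorProduct.map (MvPolynomial.aeval y) (AlgHom.id k B)).toRingHom.comp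
        (Algebra.TensorProduct.comm k B (MvPolynomial (Fin r) k)).toAlgHom.toRingHom).comp
        (MvPolynomial.algebraTensorAlgEquiv k B).symm.toAlgHom.toRingHom := by
      refine MvPolynomial.ringHom_ext (fun b => ?_) fun j => ?_
      · have hC : (MvPolynomial.algebraTensorAlgEquiv k B).symm (MvPolynomial.C b) =
            b ⊗ₜ[k] (1 : MvPolynomial (Fin r) k) :=
          (MvPolynomial.algebraTensorAlgEquiv k B).symm.commutes b
        have ha : a (MvPolynomial.C b) = 1 ⊗ₜ b := MvPolynomial.aeval_C _ b
        change ι (a (MvPolynomial.C b)) = Algebra.TensorProduct.map (MvPolynomial.aeval y)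
          (AlgHom.id k B) (Algebra.TensorProduct.comm k B (MvPolynomial (Fin r) k)
            ((MvPolynomial.algebraTensorAlgEquiv k B).symm (MvPolynomial.C b)))
        rw [hC, ha]
        simp [ι]
      · simp [h, a, ι, i, y]
    rw [key]
    refine RingHom.Flat.comp (RingHom.Flat.of_bijective (AlgEquiv.bijective _))
      (RingHom.Flat.comp (RingHom.Flat.of_bijective (AlgEquiv.bijective _)) ?_)
    exact RingHom.Flat.tensorProductMap (MvPolynomial.flat_aeval_of_algebraicIndependent hy)
      (RingHom.Flat.id B)
  let : Algebra (A ⊗[k] B) (F ⊗[k] B) := ι.toRingHom.toAlgebra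
  have : IsScalarTower A (A ⊗[k] B) (F ⊗[k] B) := by
    refine .of_algebraMap_eq fun c => ?_
    change algebraMap A F c ⊗ₜ[k] (1 : B) = ι (c ⊗ₜ 1)
    simp [ι, i]
  have hloc : IsLocalization (Algebra.algebraMapSubmonoid (A ⊗[k] B) (nonZeroDivisors A))
      (F ⊗[k] B) := by
    refine IsLocalization.tensorProduct_tensorProduct k B (nonZeroDivisors A) F ?_
    ext b
    change ι (1 ⊗ₜ b) = 1 ⊗ₜ b
    simp [ι]
  have hdisj : Disjoint (Algebra.algebraMapSubmonoid (A ⊗[k] B) (nonZeroDivisors A) :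
      Set (A ⊗[k] B)) N := by
    rw [Set.disjoint_left]
    rintro _ ⟨c, hc, rfl⟩ hcN
    have : c ∈ N.comap (algebraMap A (A ⊗[k] B)) := hcN
    rw [hNA] at this
    exact nonZeroDivisors.ne_zero hc this
  let N' := N.map (algebraMap (A ⊗[k] B) (F ⊗[k] B))
  have hN' : N'.IsPrime := IsLocalization.isPrime_of_isPrime_disjoint _ _ N ‹_› hdisj
  rw [← IsLocalization.height_map_of_disjoint
    (Algebra.algebraMapSubmonoid (A ⊗[k] B) (nonZeroDivisors A)) (S := F ⊗[k] B) N hdisj]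
  let : Algebra (MvPolynomial (Fin r) B) (F ⊗[k] B) := h.toAlgebra
  have : Module.Flat (MvPolynomial (Fin r) B) (F ⊗[k] B) := hflat
  have : N'.LiesOver Q := by
    constructor
    have : N'.comap (algebraMap (A ⊗[k] B) (F ⊗[k] B)) = N :=
      IsLocalization.under_map_of_isPrime_disjoint _ _ ‹_› hdisj
    change N.comap a = N'.comap h
    rw [← this]
    rfl
  exact Ideal.height_le_height_of_hasGoingDown Q N'

theorem eTrdeg_quotient_tensorProduct_le {k A B : Type u} [Field k] [CommRing A] [CommRing B]
    [IsDomain B] [Algebra k A] [Algebra k B] (I : Ideal (A ⊗[k] B)) [I.IsPrime] :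
    eTrdeg B ((A ⊗[k] B) ⧸ I) ≤ eTrdeg k A := by
  refine eTrdeg_le_of_adjoin_range_eq_top
    ((Ideal.Quotient.mkₐ k I).comp (Algebra.TensorProduct.includeLeft : A →ₐ[k] A ⊗[k] B)) ?_
  refine eq_top_iff.mpr fun z _ => ?_
  obtain ⟨w, rfl⟩ := Ideal.Quotient.mk_surjective z
  induction w with
  | zero => rw [map_zero]; exact zero_mem _
  | add u v hu hv => rw [map_add]; exact add_mem (hu trivial) (hv trivial)
  | tmul a b =>
    have hab : a ⊗ₜ[k] b = (a ⊗ₜ 1) * (1 ⊗ₜ b) := by simp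
    rw [hab, map_mul]
    exact mul_mem (Algebra.subset_adjoin ⟨a, rfl⟩) (Subalgebra.algebraMap_mem _ b)

end TensorProduct

theorem add_eTrdeg_le_of_strictMono {B R : Type u} [CommRing B] [IsDomain B] [CommRing R]
    [Algebra B R] {s : ℕ} (c : Fin (s + 1) → Ideal R) (hc : StrictMono c)
    (hprime : ∀ i, (c i).IsPrime) (hbot : ∀ i, (c i).comap (algebraMap B R) = ⊥) :
    (s : ℕ∞) + eTrdeg B (R ⧸ c (Fin.last s)) ≤ eTrdeg B (R ⧸ c 0) := by
  induction s with
  | zero => simp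
  | succ s ih =>
    have h1 := ih (c ∘ Fin.castSucc) (hc.comp (Fin.strictMono_castSucc))
      (fun i => hprime _) (fun i => hbot _)
    have hlt : c (Fin.last s).castSucc < c (Fin.last (s + 1)) := hc (Fin.castSucc_lt_last _)
    have := hprime (Fin.last s).castSucc
    have := hprime (Fin.last (s + 1))
    have h2 : eTrdeg B (R ⧸ c (Fin.last (s + 1))) + 1 ≤
        eTrdeg B (R ⧸ c (Fin.last s).castSucc) := by
      refine eTrdeg_add_one_le_of_surjective ?_ (Ideal.Quotient.factorₐ B hlt.le)
        (Ideal.Quotient.factor_surjective hlt.le) fun hinj => hlt.not_ge fun z hz => ?_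
      · rw [injective_iff_map_eq_zero]
        intro b hb
        have hmem : algebraMap B R b ∈ c (Fin.last (s + 1)) := Ideal.Quotient.eq_zero_iff_mem.mp hb
        rwa [← Ideal.mem_comap, hbot, Ideal.mem_bot] at hmem
      · rw [← Ideal.Quotient.eq_zero_iff_mem] at hz ⊢
        exact (injective_iff_map_eq_zero _).mp hinj _ hz
    refine le_trans ?_ h1
    rw [Nat.cast_succ, add_assoc, add_comm 1]
    exact add_le_add_right h2 _

theorem exists_aeval_mem_imp_mem_polyExt {B R R' : Type*} [CommRing B] [CommRing R] [CommRing R']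
    (q : Ideal B) [q.IsPrime] [Algebra B R] [Algebra (B ⧸ q) R'] {g : R →+* R'}
    (hg : Function.Surjective g)
    (hgB : ∀ b, g (algebraMap B R b) = algebraMap (B ⧸ q) R' (Ideal.Quotient.mk q b))
    (N : Ideal R') [N.IsPrime] (hN : N.comap (algebraMap (B ⧸ q) R') = ⊥) {e : ℕ}
    (he : eTrdeg (B ⧸ q) (R' ⧸ N) = e) :
    ∃ x : Fin e → R, ∀ f, MvPolynomial.aeval x f ∈ N.comap g → f ∈ polyExt e q := by
  have hinj : Function.Injective (algebraMap (B ⧸ q) (R' ⧸ N)) := by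
    rw [injective_iff_map_eq_zero]
    intro b hb
    have hmem : algebraMap (B ⧸ q) R' b ∈ N := Ideal.Quotient.eq_zero_iff_mem.mp hb
    rwa [← Ideal.mem_comap, hN, Ideal.mem_bot] at hmem
  obtain ⟨y, hy⟩ := exists_isTranscendenceBasis_fin hinj he
  choose x hx using fun i => (Ideal.Quotient.mk_surjective.comp hg) (y i)
  refine ⟨x, fun f hf => ?_⟩
  have key : ((Ideal.Quotient.mk N).comp g).comp (MvPolynomial.aeval x).toRingHom =
      (MvPolynomial.aeval y).toRingHom.comp (MvPolynomial.map (Ideal.Quotient.mk q)) := by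
    refine MvPolynomial.ringHom_ext (fun b => ?_) fun j => ?_
    · simp [hgB]
    · simpa using hx j
  have h0 : MvPolynomial.aeval y (MvPolynomial.map (Ideal.Quotient.mk q) f) = 0 :=
    (RingHom.congr_fun key f).symm.trans (Ideal.Quotient.eq_zero_iff_mem.mpr hf)
  have h1 := (injective_iff_map_eq_zero _).mp hy.1 _ h0
  rwa [← RingHom.mem_ker, MvPolynomial.ker_map, Ideal.mk_ker] at h1

theorem height_map_eq_idealHt_map_mk {R R' : Type*} [CommRing R] [CommRing R'] {g : R →+* R'}
    (hg : Function.Surjective g) (P : Ideal R) [P.IsPrime] (hP : RingHom.ker g ≤ P) :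
    (P.map g).height = idealHt (P.map (Ideal.Quotient.mk (RingHom.ker g))) := by
  have : (P.map (Ideal.Quotient.mk (RingHom.ker g))).IsPrime :=
    Ideal.map_isPrime_of_surjective Ideal.Quotient.mk_surjective (by rwa [Ideal.mk_ker])
  let e := RingHom.quotientKerEquivOfSurjective hg
  have h : P.map g = (P.map (Ideal.Quotient.mk (RingHom.ker g))).map (e : _ →+* R') := by
    rw [Ideal.map_map]; rfl
  rw [idealHt_eq_height, h]
  exact e.height_map _

theorem natCast_le_sub_add_add {s e t r : ℕ} {m h : ℕ∞} (hrt : r ≤ t)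
    (hs : (s : ℕ∞) + e ≤ t + m) (hr : (r : ℕ∞) ≤ e + h) :
    (s : ℕ∞) ≤ ((t - r : ℕ) : ℕ∞) + m + h := by
  rcases eq_or_ne m ⊤ with rfl | hm
  · simp
  rcases eq_or_ne h ⊤ with rfl | hh
  · simp
  lift m to ℕ using hm
  lift h to ℕ using hh
  norm_cast at *
  omega

section TensorProduct

attribute [local instance] Algebra.TensorProduct.rightAlgebra

theorem length_le_of_chain {k A B : Type u} [Field k] [CommRing A] [CommRing B]
    [IsDomain B] [Algebra k A] [Algebra k B] {t r : ℕ} (ht : eTrdeg k A = t)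
    (P : Ideal (A ⊗[k] B)) [P.IsPrime]
    (p : Ideal A) (hp : p = P.comap (algebraMap A (A ⊗[k] B)))
    (q : Ideal B) (hq : q = P.comap (algebraMap B (A ⊗[k] B)))
    (hr : eTrdeg k (A ⧸ p) = r) {s : ℕ} (c : Fin (s + 1) → Ideal (A ⊗[k] B))
    (hc : StrictMono c) (hprime : ∀ i, (c i).IsPrime) (hlast : c (Fin.last s) = P)
    (hbot : ∀ i, i ≠ Fin.last s → (c i).comap (algebraMap B (A ⊗[k] B)) = ⊥) :
    (s : ℕ∞) ≤ ((t - r : ℕ) : ℕ∞) + idealHt (polyExt r q) +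
      idealHt (P.map (Ideal.Quotient.mk
        (p.map (Algebra.TensorProduct.includeLeft : A →ₐ[k] A ⊗[k] B).toRingHom ⊔
         q.map (Algebra.TensorProduct.includeRight : B →ₐ[k] A ⊗[k] B).toRingHom))) := by
  obtain _ | s := s
  · simp
  have : p.IsPrime := hp ▸ inferInstance
  have : q.IsPrime := hq ▸ inferInstance
  let g : A ⊗[k] B →ₐ[k] (A ⧸ p) ⊗[k] (B ⧸ q) :=
    Algebra.TensorProduct.map (Ideal.Quotient.mkₐ k p) (Ideal.Quotient.mkₐ k q)
  have hg : Function.Surjective g :=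
    TensorProduct.map_surjective Ideal.Quotient.mk_surjective Ideal.Quotient.mk_surjective
  have hker : RingHom.ker g.toRingHom =
      p.map (Algebra.TensorProduct.includeLeft : A →ₐ[k] A ⊗[k] B).toRingHom ⊔
      q.map (Algebra.TensorProduct.includeRight : B →ₐ[k] A ⊗[k] B).toRingHom := by
    have h := Algebra.TensorProduct.map_ker (Ideal.Quotient.mkₐ k p) (Ideal.Quotient.mkₐ k q)
      Ideal.Quotient.mk_surjective Ideal.Quotient.mk_surjective
    have hkp : RingHom.ker (Ideal.Quotient.mkₐ k p) = p := Ideal.Quotient.mkₐ_ker k p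
    have hkq : RingHom.ker (Ideal.Quotient.mkₐ k q) = q := Ideal.Quotient.mkₐ_ker k q
    rwa [hkp, hkq] at h
  have hkerP : RingHom.ker g.toRingHom ≤ P := by
    rw [hker]
    exact sup_le (Ideal.map_le_iff_le_comap.mpr hp.le) (Ideal.map_le_iff_le_comap.mpr hq.le)
  let N := P.map g.toRingHom
  have hN : N.IsPrime := Ideal.map_isPrime_of_surjective hg hkerP
  have hNP : N.comap g.toRingHom = P := by
    exact (Ideal.comap_map_of_surjective' g.toRingHom hg P).trans (sup_eq_left.mpr hkerP)
  have hNA : N.comap (algebraMap (A ⧸ p) ((A ⧸ p) ⊗[k] (B ⧸ q))) = ⊥ := by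
    refine eq_bot_iff.mpr fun a ha => ?_
    obtain ⟨a, rfl⟩ := Ideal.Quotient.mk_surjective a
    have h : a ⊗ₜ[k] (1 : B) ∈ N.comap g.toRingHom := ha
    rw [hNP] at h
    exact Ideal.Quotient.eq_zero_iff_mem.mpr (hp ▸ h)
  have hNB : N.comap (algebraMap (B ⧸ q) ((A ⧸ p) ⊗[k] (B ⧸ q))) = ⊥ := by
    refine eq_bot_iff.mpr fun b hb => ?_
    obtain ⟨b, rfl⟩ := Ideal.Quotient.mk_surjective b
    have h : (1 : A) ⊗ₜ[k] b ∈ N.comap g.toRingHom := hb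
    rw [hNP] at h
    exact Ideal.Quotient.eq_zero_iff_mem.mpr (hq ▸ h)
  have hrt : r ≤ t := by
    have := eTrdeg_le_of_surjective (Ideal.Quotient.mkₐ k p) Ideal.Quotient.mk_surjective
    rw [ht, hr] at this
    exact_mod_cast this
  have her := eTrdeg_quotient_tensorProduct_le N
  rw [hr] at her
  obtain ⟨e, he⟩ := ENat.ne_top_iff_exists.mp (ne_top_of_le_ne_top (ENat.natCast_ne_top r) her)
  rw [← he, Nat.cast_le] at her
  obtain ⟨y, hy⟩ := exists_isTranscendenceBasis_fin (algebraMap k (A ⧸ p)).injective hr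
  have hrN := le_eTrdeg_add_height_tensorProduct N hNA hNB hy.1
  obtain ⟨x, hx⟩ := exists_aeval_mem_imp_mem_polyExt (R := A ⊗[k] B) q (g := g.toRingHom) hg
    (fun b => rfl) N hNB he.symm
  rw [hNP] at hx
  rw [← he, height_map_eq_idealHt_map_mk hg P hkerP, hker] at hrN
  have hmono : (polyExt e q).height ≤ (polyExt r q).height := height_polyExt_mono q her
  rw [idealHt_eq_height (polyExt r q)]
  have hse : ((s + 1 : ℕ) : ℕ∞) + e ≤ t + (polyExt e q).height := by
    have hstart : ∀ i, eTrdeg B ((A ⊗[k] B) ⧸ c i) ≤ t := fun i => by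
      have := hprime i
      exact (eTrdeg_quotient_tensorProduct_le (c i)).trans_eq ht
    rcases eq_or_ne q ⊥ with hq0 | hq0
    · have hPbot : P.comap (algebraMap B (A ⊗[k] B)) = ⊥ := hq.symm.trans hq0
      have hbot' : ∀ i, (c i).comap (algebraMap B (A ⊗[k] B)) = ⊥ := fun i =>
        (eq_or_ne i (Fin.last (s + 1))).elim (fun hi => by rw [hi, hlast, hPbot]) (hbot i)
      have hchain := (add_eTrdeg_le_of_strictMono c hc hprime hbot').trans (hstart 0)
      rw [hlast] at hchain
      have he' := (le_eTrdeg_add_height_polyExt x P P le_rfl hPbot q hx).1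
      refine (add_le_add_right he' _).trans ?_
      rw [← add_assoc]
      exact add_le_add_left hchain _
    · have hne : ∀ i : Fin (s + 1), i.castSucc ≠ Fin.last (s + 1) :=
        fun i => (Fin.castSucc_lt_last i).ne
      have hchain := (add_eTrdeg_le_of_strictMono (c ∘ Fin.castSucc)
        (hc.comp Fin.strictMono_castSucc) (fun i => hprime _) fun i => hbot _ (hne i)).trans
        (hstart _)
      have := hprime (Fin.last s).castSucc
      have he' := (le_eTrdeg_add_height_polyExt x (c (Fin.last s).castSucc) P
        (hlast ▸ hc.monotone (Fin.le_last _)) (hbot _ (hne _)) q hx).2 hq0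
      rw [Nat.cast_succ, add_assoc, add_comm 1]
      refine (add_le_add_right he' _).trans ?_
      rw [← add_assoc]
      exact add_le_add_left hchain _
  exact natCast_le_sub_add_add hrt (hse.trans (add_le_add_right hmono _)) hrN

end TensorProduct

/-- If `A` and `B` are domains and `P` is a prime of `A ⊗[k] B` with
`p = P ∩ A`, `q = P ∩ B`, then
`λ((·,(0)),P) ≤ t.d.(A) − t.d.(A/p) + ht (q[t.d.(A/p)]) + ht (P/(p⊗B + A⊗q))`. -/
theorem stmt_8 (k A B : Type) [Field k] [CommRing A] [IsDomain A] [CommRing B] [IsDomain B]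
    [Algebra k A] [Algebra k B]
    (ta tap : ℕ) (hta : eTrdeg k A = ta) (hBfin : eTrdeg k B ≠ ⊤)
    (P : Ideal (A ⊗[k] B)) (hP : P.IsPrime)
    (p : Ideal A)
    (hp : p = P.comap (Algebra.TensorProduct.includeLeft : A →ₐ[k] A ⊗[k] B).toRingHom)
    (q : Ideal B)
    (hq : q = P.comap (Algebra.TensorProduct.includeRight : B →ₐ[k] A ⊗[k] B).toRingHom)
    (htap : eTrdeg k (A ⧸ p) = tap) :
    lamZero k A B P ≤ ((ta - tap : ℕ) : ℕ∞) + idealHt (polyExt tap q) +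
      idealHt (P.map (Ideal.Quotient.mk
        (p.map (Algebra.TensorProduct.includeLeft : A →ₐ[k] A ⊗[k] B).toRingHom ⊔
         q.map (Algebra.TensorProduct.includeRight : B →ₐ[k] A ⊗[k] B).toRingHom))) := by
  refine sSup_le ?_
  rintro _ ⟨s, c, rfl, hc, hprime, hlast, hbot⟩
  exact length_le_of_chain hta P p hp q hq htap c hc hprime hlast hbot
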